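/- (Lemma 5.2, e-part: rounding error of the computed compensated term ε̂e.) Let u ≥ 0 with 4u < 1 and γ_k = k·u/(1 − k·u). Let q̂, q̂', ê'', ε̂q, ε̂q', ε̂e'' be reals with |ε̂q| ≤ u·|q̂ − ε̂q|, |ε̂q'| ≤ u·|q̂' − ε̂q'| and |ε̂e''| ≤ u·|ê'' − ε̂e''|. Suppose s = (q̂' − q̂)(1 + θ₀) for some |θ₀| ≤ u, set μ₁ = (q̂' − q̂) − s, and let μ₂ be a real with |μ₂| ≤ u·|s + ê''|. Suppose furthermore ε̂e = ε̂q'(1 + θ_a) − ε̂q(1 + θ_b) + ε̂e''(1 + θ_c) − μ₁(1 + θ_d) − μ₂(1 + θ_e) with |θ_a| ≤ γ₄, |θ_b| ≤ γ₄, |θ_c| ≤ γ₃, |θ_d| ≤ γ₂, |θ_e| ≤ γ₁, and set ε̃e* = ε̂q' − ε̂q + ε̂e'' − μ₁ − μ₂. Then |ε̂e − ε̃e*| ≤ γ₃·γ₄·(|q̂' − ε̂q'| + |q̂ − ε̂q| + |ê'' − ε̂e''|). -/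

import Mathlib

/-- `γ_k = k·u/(1 − k·u)`. -/
noncomputable def gam (u : ℝ) (k : ℕ) : ℝ := k * u / (1 - k * u)

theorem gam_nonneg {u : ℝ} (hu : 0 ≤ u) {k : ℕ} (hk : k * u < 1) : 0 ≤ gam u k :=
  div_nonneg (by positivity) (by linarith)

theorem mul_le_gam {u : ℝ} (hu : 0 ≤ u) {k : ℕ} (hk : k * u < 1) : k * u ≤ gam u k := by
  have hku : 0 ≤ k * u := by positivity
  rw [gam, le_div_iff₀ (by linarith)]
  nlinarith [mul_nonneg hku hku]

theorem gam_three_le {u : ℝ} (h4u : 4 * u < 1) :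
    gam u 3 ≤ 3 / 4 * gam u 4 := by
  simp only [gam]
  push_cast
  rw [mul_div_assoc', div_le_div_iff₀ (by linarith) (by linarith)]
  nlinarith [sq_nonneg u]

theorem one_add_mul_gam_two_le {u : ℝ} (hu : 0 ≤ u) (h4u : 4 * u < 1) :
    (1 + u) * gam u 2 ≤ 1 / 2 * gam u 4 := by
  simp only [gam]
  push_cast
  rw [mul_div_assoc', mul_div_assoc', div_le_div_iff₀ (by linarith) (by linarith)]
  nlinarith [mul_nonneg hu hu, mul_nonneg hu (mul_nonneg hu hu)]

theorem one_add_sq_mul_gam_one_le {u : ℝ} (hu : 0 ≤ u) (h4u : 4 * u < 1) :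
    (1 + u) ^ 2 * gam u 1 ≤ 1 / 4 * gam u 4 := by
  simp only [gam]
  push_cast
  rw [mul_div_assoc', mul_div_assoc', div_le_div_iff₀ (by linarith) (by linarith)]
  nlinarith [mul_nonneg hu hu, mul_nonneg hu (mul_nonneg hu hu),
    mul_nonneg (mul_nonneg hu hu) (mul_nonneg hu hu)]

theorem abs_le_one_add_mul_abs_sub {u x e : ℝ} (h : |e| ≤ u * |x - e|) :
    |x| ≤ (1 + u) * |x - e| := by
  have := abs_add_le (x - e) e
  rw [sub_add_cancel] at this
  linarith

/-- Lemma 5.2, e-part: rounding error of the computed compensated term `ε̂e` of Compqd.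
With FastTwoSum-updated inputs (`|ε̂x| ≤ u·|x̂ − ε̂x|`), `s = (q̂' − q̂)(1 + θ₀)`,
`μ₁ = (q̂' − q̂) − s`, `|μ₂| ≤ u·|s + ê''|`,
`ε̂e = ε̂q'(1 + θ_a) − ε̂q(1 + θ_b) + ε̂e''(1 + θ_c) − μ₁(1 + θ_d) − μ₂(1 + θ_e)` and
`ε̃e* = ε̂q' − ε̂q + ε̂e'' − μ₁ − μ₂`, one has
`|ε̂e − ε̃e*| ≤ γ₃·γ₄·(|q̂' − ε̂q'| + |q̂ − ε̂q| + |ê'' − ε̂e''|)`. -/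
theorem compqd_computed_compensated_e_rounding
    (u : ℝ) (hu : 0 ≤ u) (h4u : 4 * u < 1)
    (qhat qhat' ehat'' eqhat eqhat' eehat'' : ℝ)
    (h1 : |eqhat| ≤ u * |qhat - eqhat|)
    (h2 : |eqhat'| ≤ u * |qhat' - eqhat'|)
    (h3 : |eehat''| ≤ u * |ehat'' - eehat''|)
    (s θ₀ μ₁ μ₂ : ℝ)
    (hθ₀ : |θ₀| ≤ u) (hs : s = (qhat' - qhat) * (1 + θ₀))
    (hμ₁ : μ₁ = (qhat' - qhat) - s)
    (hμ₂ : |μ₂| ≤ u * |s + ehat''|)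
    (eehat θa θb θc θd θe : ℝ)
    (hθa : |θa| ≤ gam u 4) (hθb : |θb| ≤ gam u 4) (hθc : |θc| ≤ gam u 3)
    (hθd : |θd| ≤ gam u 2) (hθe : |θe| ≤ gam u 1)
    (hdef : eehat = eqhat' * (1 + θa) - eqhat * (1 + θb) + eehat'' * (1 + θc)
        - μ₁ * (1 + θd) - μ₂ * (1 + θe)) :
    |eehat - (eqhat' - eqhat + eehat'' - μ₁ - μ₂)|
      ≤ gam u 3 * gam u 4 * (|qhat' - eqhat'| + |qhat - eqhat| + |ehat'' - eehat''|) := by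
  have hg1 : 0 ≤ gam u 1 := gam_nonneg hu (k := 1) (by push_cast; linarith)
  have hg2 : 0 ≤ gam u 2 := gam_nonneg hu (k := 2) (by push_cast; linarith)
  have hg4 : 0 ≤ gam u 4 := gam_nonneg hu (k := 4) (by push_cast; linarith)
  have hg3 : 3 * u ≤ gam u 3 := by
    simpa using mul_le_gam hu (k := 3) (by push_cast; linarith)
  have hg34 := gam_three_le h4u
  have hg24 := one_add_mul_gam_two_le hu h4u
  have hg14 := one_add_sq_mul_gam_one_le hu h4u
  have hq := abs_le_one_add_mul_abs_sub h1
  have hq' := abs_le_one_add_mul_abs_sub h2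
  have he := abs_le_one_add_mul_abs_sub h3
  set A := |qhat' - eqhat'|
  set B := |qhat - eqhat|
  set C := |ehat'' - eehat''|
  have hA : 0 ≤ A := abs_nonneg _
  have hB : 0 ≤ B := abs_nonneg _
  have hC : 0 ≤ C := abs_nonneg _
  have hd : |qhat' - qhat| ≤ (1 + u) * (A + B) := by
    linarith [abs_sub qhat' qhat]
  have hm1 : |μ₁| ≤ u * ((1 + u) * (A + B)) := by
    rw [show μ₁ = -(θ₀ * (qhat' - qhat)) by rw [hμ₁, hs]; ring, abs_neg, abs_mul]
    gcongr
  have hs' : |s| ≤ (1 + u) ^ 2 * (A + B) := by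
    have hθ : |1 + θ₀| ≤ 1 + u := by
      linarith [abs_add_le 1 θ₀, abs_one (α := ℝ)]
    calc |s| = |1 + θ₀| * |qhat' - qhat| := by rw [hs, abs_mul, mul_comm]
      _ ≤ (1 + u) * ((1 + u) * (A + B)) := by gcongr
      _ = _ := by ring
  have hm2 : |μ₂| ≤ u * ((1 + u) ^ 2 * (A + B + C)) := by
    refine hμ₂.trans (mul_le_mul_of_nonneg_left ?_ hu)
    have : (1 + u) * C ≤ (1 + u) ^ 2 * C := by
      gcongr
      nlinarith
    linarith [abs_add_le s ehat'']
  have ta : |eqhat' * θa| ≤ u * A * gam u 4 := by rw [abs_mul]; gcongr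
  have tb : |eqhat * θb| ≤ u * B * gam u 4 := by rw [abs_mul]; gcongr
  have tc : |eehat'' * θc| ≤ u * C * (3 / 4 * gam u 4) := by
    rw [abs_mul]; gcongr; exact hθc.trans hg34
  have td : |μ₁ * θd| ≤ u * (A + B) * (1 / 2 * gam u 4) := by
    calc |μ₁ * θd| ≤ u * ((1 + u) * (A + B)) * gam u 2 := by rw [abs_mul]; gcongr
      _ = u * (A + B) * ((1 + u) * gam u 2) := by ring
      _ ≤ _ := by gcongr
  have te : |μ₂ * θe| ≤ u * (A + B + C) * (1 / 4 * gam u 4) := by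
    calc |μ₂ * θe| ≤ u * ((1 + u) ^ 2 * (A + B + C)) * gam u 1 := by rw [abs_mul]; gcongr
      _ = u * (A + B + C) * ((1 + u) ^ 2 * gam u 1) := by ring
      _ ≤ _ := by gcongr
  have hsum : |eehat - (eqhat' - eqhat + eehat'' - μ₁ - μ₂)|
      ≤ |eqhat' * θa| + |eqhat * θb| + |eehat'' * θc| + |μ₁ * θd| + |μ₂ * θe| := by
    rw [show eehat - (eqhat' - eqhat + eehat'' - μ₁ - μ₂)
      = eqhat' * θa - eqhat * θb + eehat'' * θc - μ₁ * θd - μ₂ * θe by rw [hdef]; ring]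
    linarith [abs_sub (eqhat' * θa - eqhat * θb + eehat'' * θc - μ₁ * θd) (μ₂ * θe),
      abs_sub (eqhat' * θa - eqhat * θb + eehat'' * θc) (μ₁ * θd),
      abs_add_le (eqhat' * θa - eqhat * θb) (eehat'' * θc),
      abs_sub (eqhat' * θa) (eqhat * θb)]
  have hABu : 0 ≤ u * gam u 4 * (A + B) := by positivity
  have hCu : 0 ≤ u * gam u 4 * C := by positivity
  calc |eehat - (eqhat' - eqhat + eehat'' - μ₁ - μ₂)|
      ≤ 3 * u * gam u 4 * (A + B + C) := by linarith
    _ ≤ gam u 3 * gam u 4 * (A + B + C) := by gcongr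
    _ = _ := by ring
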